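/- Let P be a tree on {1,…,n} with exactly k leaves. Then the leaf ideal I_L(P) ⊆ k[x_1,…,x_n] has exactly k minimal monomial generators, its Taylor complex is a minimal free resolution of it, and β_i(I_L(P)) = C(k, i+1) for every i ≥ 0. -/

import Mathlib

open MvPolynomial

/-- The squarefree monomial with support `s`: `∏_{j ∈ s} x_j`. -/
noncomputable def sfMon (𝕜 : Type) [Field 𝕜] {σ : Type} (s : Finset σ) : MvPolynomial σ 𝕜 :=
  ∏ j ∈ s, X j

/-- The supports of the minimal monomial generating set `G(I)` of a squarefree monomial
ideal `I`: supports `s` of squarefree monomials in `I` no proper (squarefree) divisor of which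
lies in `I`. -/
def sqfreeMinGens {𝕜 : Type} [Field 𝕜] {σ : Type} (I : Ideal (MvPolynomial σ 𝕜)) :
    Set (Finset σ) :=
  { s | sfMon 𝕜 s ∈ I ∧ ∀ t : Finset σ, t ⊂ s → sfMon 𝕜 t ∉ I }

/-- `C_i(I) = ⋂ { supp m : m ∈ G(I), x_i ∣ m }`. -/
def suppC {𝕜 : Type} [Field 𝕜] {σ : Type} (I : Ideal (MvPolynomial σ 𝕜)) (i : σ) : Set σ :=
  ⋂ s ∈ { s | s ∈ sqfreeMinGens I ∧ i ∈ s }, (s : Set σ)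


open Classical

/-- A partial order `P` on `α` is a forest if, for every `p`, the set of elements strictly
below `p` is a chain. -/
def IsPForest {α : Type} (P : PartialOrder α) : Prop :=
  ∀ p q r : α, P.lt q p → P.lt r p → P.le q r ∨ P.le r q

/-- `l` is maximal (a leaf) for the partial order `P`. -/
def PIsMax {α : Type} (P : PartialOrder α) (l : α) : Prop := ∀ q, P.le l q → q = l

/-- `r` is minimal (a root) for the partial order `P`. -/
def PIsMin {α : Type} (P : PartialOrder α) (r : α) : Prop := ∀ q, P.le q r → q = r

/-- `q` is a child of `p`: `q` covers `p` in `P`. -/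
def PChild {α : Type} (P : PartialOrder α) (p q : α) : Prop :=
  P.lt p q ∧ ∀ r, P.lt p r → ¬ P.lt r q

/-- The leaf ideal of a forest `P` on `{1,…,n}`:
`I_L(P) = ⟨ ∏_{j ≤_P l} x_j : l a leaf of P ⟩`. -/
noncomputable def leafIdeal (𝕜 : Type) [Field 𝕜] {n : ℕ} (P : PartialOrder (Fin n)) :
    Ideal (MvPolynomial (Fin n) 𝕜) :=
  Ideal.span { f | ∃ l : Fin n, PIsMax P l ∧
    f = sfMon 𝕜 (Finset.univ.filter (fun j => P.le j l)) }

open CategoryTheory in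
/-- The `i`-th total Betti number of `I ⊆ R = 𝕜[x_j : j ∈ σ]`:
`β_i(I) = dim_𝕜 Tor_i^R(I, 𝕜)`, where `𝕜` carries the `R`-module structure of the
residue field `R ⧸ (x_j : j ∈ σ)`. -/
noncomputable def betti (𝕜 : Type) [Field 𝕜] {σ : Type} (I : Ideal (MvPolynomial σ 𝕜)) (i : ℕ) :
    Cardinal :=
  Module.rank 𝕜 (RestrictScalars 𝕜 (MvPolynomial σ 𝕜)
    (((Tor (ModuleCat (MvPolynomial σ 𝕜)) i).obj (ModuleCat.of _ I)).obj
      (ModuleCat.of _ (MvPolynomial σ 𝕜 ⧸ Ideal.span (Set.range (X : σ → MvPolynomial σ 𝕜))))))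


namespace LeafProof
section abs
open CategoryTheory MonoidalCategory
variable {R : Type} [CommRing R] {N : ModuleCat.{0} R} (P : ProjectiveResolution N)

/-- `M ⊗ P` -/
noncomputable def G : ModuleCat.{0} R ⥤ ChainComplex (ModuleCat.{0} R) ℕ where
  obj M := (((tensoringLeft (ModuleCat.{0} R)).obj M).mapHomologicalComplex _).obj P.complex
  map f := (NatTrans.mapHomologicalComplex ((tensoringLeft (ModuleCat.{0} R)).map f) _).app P.complex
  map_id M := by ext; simp
  map_comp f g := by ext; simp

noncomputable def T (i : ℕ) : ModuleCat.{0} R ⥤ ModuleCat.{0} R :=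
  G P ⋙ HomologicalComplex.homologyFunctor _ _ i

noncomputable def torIso (i : ℕ) (M : ModuleCat.{0} R) :
    ((Tor (ModuleCat R) i).obj M).obj N ≅ (T P i).obj M :=
  P.isoLeftDerivedObj _ i

lemma G_map_f {M M' : ModuleCat.{0} R} (f : M ⟶ M') (i : ℕ) :
    ((G P).map f).f i = f ▷ (P.complex.X i) := rfl

lemma rT {M M' : ModuleCat.{0} R} (f : M ⟶ M') (Q : ModuleCat.{0} R) :
   (f ▷ Q).hom = LinearMap.rTensor Q f.hom := rfl

lemma sesG (S : ShortComplex (ModuleCat.{0} R)) (hS : S.ShortExact)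
   : ∃ w, (ShortComplex.mk ((G P).map S.f) ((G P).map S.g) w).ShortExact := by
  have w : (G P).map S.f ≫ (G P).map S.g = 0 := by
    rw [← Functor.map_comp, S.zero]
    ext i : 1
    simp only [G_map_f, MonoidalPreadditive.zero_whiskerRight]
    rfl
  refine ⟨w, HomologicalComplex.shortExact_of_degreewise_shortExact _ fun i => ?_⟩
  have hp : Module.Projective R (P.complex.X i) := by
    exact (IsProjective.iff_projective (P.complex.X i)).2 (P.projective i)
  have hfl : Module.Flat R (P.complex.X i) := inferInstance
  refine { exact := ?_, mono_f := ?_, epi_g := ?_ }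
  · rw [ShortComplex.ShortExact.moduleCat_exact_iff_function_exact]
    exact Module.Flat.rTensor_exact _ ((ShortComplex.ShortExact.moduleCat_exact_iff_function_exact _).1 hS.exact)
  · rw [ModuleCat.mono_iff_injective]
    exact Module.Flat.rTensor_preserves_injective_linearMap _ hS.moduleCat_injective_f
  · rw [ModuleCat.epi_iff_surjective]
    exact LinearMap.rTensor_surjective _ hS.moduleCat_surjective_g

/-- exactness in the middle -/
lemma T_mid (S : ShortComplex (ModuleCat.{0} R)) (hS : S.ShortExact) (i : ℕ) :
    Function.Exact ((T P i).map S.f) ((T P i).map S.g) := by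
  obtain ⟨w, h⟩ := sesG P S hS
  exact (ShortComplex.ShortExact.moduleCat_exact_iff_function_exact _).1 (h.homology_exact₂ i)

lemma T_surj0 (S : ShortComplex (ModuleCat.{0} R)) (hS : S.ShortExact) :
    Function.Surjective ((T P 0).map S.g) := by
  obtain ⟨w, h⟩ := sesG P S hS
  have : Epi (HomologicalComplex.homologyMap ((G P).map S.g) 0) := by
    have := h.epi_g
    apply HomologicalComplex.epi_homologyMap_of_epi_of_not_rel ((G P).map S.g) 
    simp
  exact (ModuleCat.epi_iff_surjective _).1 this

lemma T_les (S : ShortComplex (ModuleCat.{0} R)) (hS : S.ShortExact) (i : ℕ) :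
    ∃ d : (T P (i+1)).obj S.X₃ ⟶ (T P i).obj S.X₁,
      Function.Exact ((T P (i+1)).map S.g) d ∧ Function.Exact d ((T P i).map S.f) := by
  obtain ⟨w, h⟩ := sesG P S hS
  refine ⟨h.δ (i+1) i (by simp), ?_, ?_⟩
  · exact (ShortComplex.ShortExact.moduleCat_exact_iff_function_exact _).1 (h.homology_exact₃ _ _ _)
  · exact (ShortComplex.ShortExact.moduleCat_exact_iff_function_exact _).1 (h.homology_exact₁ _ _ _)

lemma T_smul (r : R) (hr : ∀ x : N, r • x = 0) (M : ModuleCat.{0} R) (i : ℕ) :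
    (T P i).map (r • 𝟙 M) = 0 := by
  have h1 : Homotopy (r • 𝟙 P.complex) 0 := by
    apply ProjectiveResolution.liftHomotopyZero (P := P) (Q := P)
    have : r • P.π = 0 := by
      apply HomologicalComplex.to_single_hom_ext
      apply ModuleCat.hom_ext
      apply LinearMap.ext
      intro x
      exact hr _
    rw [Linear.smul_comp, Category.id_comp, this]
  have h2 := Functor.mapHomotopy ((tensoringLeft (ModuleCat.{0} R)).obj M) h1
  have h3 : (G P).map (r • 𝟙 M) = (((tensoringLeft (ModuleCat.{0} R)).obj M).mapHomologicalComplex _).map (r • 𝟙 P.complex) := by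
    ext i : 1
    rw [G_map_f]
    simp
    rfl
  change HomologicalComplex.homologyMap ((G P).map (r • 𝟙 M)) i = 0
  rw [h3]
  refine (h2.homologyMap_eq i).trans ?_
  rw [Functor.map_zero, HomologicalComplex.homologyMap_zero]
  rfl

/-- maps from `A` into `R` with image in annihilator kill `T 0` -/
lemma T_zero_R (A : ModuleCat.{0} R) (f : A ⟶ ModuleCat.of R R)
    (hf : ∀ a : A, ∀ x : N, (f a : R) • x = 0) : (T P 0).map f = 0 := by
  change HomologicalComplex.homologyMap ((G P).map f) 0 = 0
  rw [← cancel_epi (HomologicalComplex.homologyπ _ _)]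
  have := HomologicalComplex.isIso_iCycles ((G P).obj A) 0 ((ComplexShape.down ℕ).next 0) rfl (HomologicalComplex.shape _ _ _ (by simp))
  rw [← cancel_epi (inv (HomologicalComplex.iCycles ((G P).obj A) 0))]
  have := HomologicalComplex.isIso_iCycles ((G P).obj (ModuleCat.of R R)) 0 ((ComplexShape.down ℕ).next 0) rfl (HomologicalComplex.shape _ _ _ (by simp))
  have key : ∀ (X Y : ModuleCat.{0} R) (g : X ⟶ Y) [IsIso (HomologicalComplex.iCycles ((G P).obj X) 0)]
     [IsIso (HomologicalComplex.iCycles ((G P).obj Y) 0)],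
     ((G P).map g).f 0 ≫ inv (HomologicalComplex.iCycles ((G P).obj Y) 0) ≫ 
      (HomologicalComplex.homologyπ _ _) = 
     inv (HomologicalComplex.iCycles ((G P).obj X) 0) ≫ (HomologicalComplex.homologyπ _ _) ≫ 
       HomologicalComplex.homologyMap ((G P).map g) 0 := by
    intro X Y g _ _
    rw [HomologicalComplex.homologyπ_naturality, IsIso.eq_inv_comp, 
      ← HomologicalComplex.cyclesMap_i_assoc, IsIso.hom_inv_id_assoc]
  rw [← key]
  simp only [Limits.comp_zero]
  apply ModuleCat.hom_ext
  apply TensorProduct.ext'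
  intro a p
  have h2 := key _ _ (f a • 𝟙 (ModuleCat.of R R))
  have h3 : HomologicalComplex.homologyMap ((G P).map (f a • 𝟙 (ModuleCat.of R R))) 0 = 0 := T_smul P (f a) (hf a) _ 0
  rw [h3] at h2
  simp only [Limits.comp_zero] at h2
  have h4 := congrArg (fun q => q.hom ((1 : R) ⊗ₜ[R] p)) h2
  have e : (((G P).map f).f 0).hom (a ⊗ₜ[R] p) =
      (((G P).map (f a • 𝟙 (ModuleCat.of R R))).f 0).hom ((1 : R) ⊗ₜ[R] p) := by
    change (f a : R) ⊗ₜ[R] p = ((f a : R) • (1 : R)) ⊗ₜ[R] p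
    rw [smul_eq_mul, mul_one]
  exact (congrArg (fun y => (inv (HomologicalComplex.iCycles ((G P).obj (ModuleCat.of R R)) 0) ≫
        HomologicalComplex.homologyπ ((G P).obj (ModuleCat.of R R)) 0).hom y) e).trans h4

noncomputable def unitG : (G P).obj (ModuleCat.of R R) ≅ P.complex :=
  HomologicalComplex.Hom.isoOfComponents (fun i => λ_ (P.complex.X i)) (by
    intro i j _
    exact (leftUnitor_naturality (P.complex.d i j)).symm)

lemma T_R_succ (i : ℕ) : Limits.IsZero ((T P (i+1)).obj (ModuleCat.of R R)) := by
  have h := (HomologicalComplex.exactAt_iff_isZero_homology _ _).1 (P.complex_exactAt_succ i)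
  exact h.of_iso ((HomologicalComplex.homologyFunctor _ _ (i+1)).mapIso (unitG P))

noncomputable def T_R_zero : (T P 0).obj (ModuleCat.of R R) ≅ N :=
  ((HomologicalComplex.homologyFunctor _ _ 0).mapIso (unitG P)) ≪≫
    (isoOfQuasiIsoAt P.π 0) ≪≫
    (HomologicalComplex.homologyFunctorSingleIso _ _ 0).app N

section rk
variable (𝕜 : Type) [Field 𝕜] [Algebra 𝕜 R]

noncomputable def rk (M : Type) [AddCommGroup M] [Module R M] : Cardinal :=
  Module.rank 𝕜 (RestrictScalars 𝕜 R M)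

lemma rk_eq (M : Type) [AddCommGroup M] [Module R M] : rk (R := R) 𝕜 M =
    @Module.rank 𝕜 M _ _ (Module.compHom M (algebraMap 𝕜 R)) := rfl

lemma rk_ses {A B C : Type} [AddCommGroup A] [Module R A] [AddCommGroup B] [Module R B]
    [AddCommGroup C] [Module R C] (f : A →ₗ[R] B) (g : B →ₗ[R] C) (hf : Function.Injective f)
    (hg : Function.Surjective g) (h : Function.Exact f g) :
    rk (R := R) 𝕜 B = rk (R := R) 𝕜 A + rk (R := R) 𝕜 C := by
  rw [rk_eq, rk_eq, rk_eq]
  let _ := Module.compHom A (algebraMap 𝕜 R)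
  let _ := Module.compHom B (algebraMap 𝕜 R)
  let _ := Module.compHom C (algebraMap 𝕜 R)
  let f' : A →ₗ[𝕜] B :=
    { toFun := f, map_add' := f.map_add, map_smul' := fun r x => f.map_smul (algebraMap 𝕜 R r) x }
  let g' : B →ₗ[𝕜] C :=
    { toFun := g, map_add' := g.map_add, map_smul' := fun r x => g.map_smul (algebraMap 𝕜 R r) x }
  have h1 := g'.rank_range_add_rank_ker
  have h2 : LinearMap.range g' = ⊤ := LinearMap.range_eq_top.2 hg
  have h3 : LinearMap.ker g' = LinearMap.range f' := by
    ext x; exact h x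
  rw [h2, h3, rank_top, rank_range_of_injective f' hf] at h1
  rw [← h1, add_comm]

lemma rk_congr {A B : Type} [AddCommGroup A] [Module R A] [AddCommGroup B] [Module R B]
    (e : A ≃ₗ[R] B) : rk (R := R) 𝕜 A = rk (R := R) 𝕜 B := by
  let f' : RestrictScalars 𝕜 R A ≃ₗ[𝕜] RestrictScalars 𝕜 R B :=
    { e with 
      map_smul' := fun r x => e.map_smul (algebraMap 𝕜 R r) x }
  exact f'.rank_eq

lemma rk_zero {A : Type} [AddCommGroup A] [Module R A] [Subsingleton A] : rk (R := R) 𝕜 A = 0 := by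
  rw [rk_eq]
  let _ := Module.compHom A (algebraMap 𝕜 R)
  exact rank_subsingleton' _ _

/-- the short exact sequence of a product -/
lemma prod_ses (B C : ModuleCat.{0} R) :
    (ShortComplex.mk (X₁ := B) (X₂ := ModuleCat.of R (B × C)) (X₃ := C)
      (ModuleCat.ofHom (LinearMap.inl R B C)) 
      (ModuleCat.ofHom (LinearMap.snd R B C)) (by ext; simp)).ShortExact := by
  refine { exact := ?_, mono_f := ?_, epi_g := ?_ }
  · rw [ShortComplex.ShortExact.moduleCat_exact_iff_function_exact]
    exact Function.Exact.inl_snd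
  · rw [ModuleCat.mono_iff_injective]
    exact LinearMap.inl_injective
  · rw [ModuleCat.epi_iff_surjective]
    exact LinearMap.snd_surjective

lemma T_retr {X Y : ModuleCat.{0} R} (f : X ⟶ Y) (g : Y ⟶ X) (h : f ≫ g = 𝟙 X) (i : ℕ)
    (x : (T P i).obj X) : (T P i).map g ((T P i).map f x) = x := by
  have : (T P i).map f ≫ (T P i).map g = 𝟙 _ := by rw [← Functor.map_comp, h, CategoryTheory.Functor.map_id]
  have := congrArg (fun q => q.hom x) this
  exact this

lemma T_prod_zero (B C : ModuleCat.{0} R) (i : ℕ) (x : (T P i).obj (ModuleCat.of R (B × C)))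
    (h1 : (T P i).map (Y := B) (ModuleCat.ofHom (LinearMap.fst R B C)) x = 0)
    (h2 : (T P i).map (Y := C) (ModuleCat.ofHom (LinearMap.snd R B C)) x = 0) : x = 0 := by
  obtain ⟨y, rfl⟩ := (T_mid P _ (prod_ses B C) i x).1 h2
  have := T_retr P (X := B) (ModuleCat.ofHom (LinearMap.inl R B C)) 
    (ModuleCat.ofHom (LinearMap.fst R B C)) (by ext; simp) i y
  rw [← this]
  erw [h1]
  simp

lemma T_prod_rk (B C : ModuleCat.{0} R) (i : ℕ) :
    rk (R := R) 𝕜 ((T P i).obj (ModuleCat.of R (B × C))) =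
      rk (R := R) 𝕜 ((T P i).obj B) + rk (R := R) 𝕜 ((T P i).obj C) := by
  refine rk_ses 𝕜 ((T P i).map (ModuleCat.ofHom (LinearMap.inl R B C))).hom
    ((T P i).map (ModuleCat.ofHom (LinearMap.snd R B C))).hom ?_ ?_ (T_mid P _ (prod_ses B C) i)
  · apply Function.LeftInverse.injective (g := (T P i).map (ModuleCat.ofHom (LinearMap.fst R B C)))
    exact T_retr P (X := B) (ModuleCat.ofHom (LinearMap.inl R B C)) 
      (ModuleCat.ofHom (LinearMap.fst R B C)) (by ext; simp) i 
  · apply Function.RightInverse.surjective (g := (T P i).map (ModuleCat.ofHom (LinearMap.inr R B C)))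
    exact T_retr P (X := C) (ModuleCat.ofHom (LinearMap.inr R B C)) 
      (ModuleCat.ofHom (LinearMap.snd R B C)) (by ext; simp) i 

/-- the inductive step -/
lemma step {A B C : Type} [AddCommGroup A] [Module R A] [AddCommGroup B] [Module R B]
    [AddCommGroup C] [Module R C] (f : A →ₗ[R] B) (φ : A →ₗ[R] R) (g : (B × R) →ₗ[R] C)
    (hinj : Function.Injective (f.prod φ)) (hex : Function.Exact (f.prod φ) g)
    (hsur : Function.Surjective g)
    (hφ : ∀ a (x : N), φ a • x = 0)
    (hf : ∃ (r : R) (f' : A →ₗ[R] B), (∀ x : N, r • x = 0) ∧ f = r • f') :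
    rk (R := R) 𝕜 ((T P 0).obj (ModuleCat.of R C)) = 
      rk (R := R) 𝕜 ((T P 0).obj (ModuleCat.of R B)) + rk (R := R) 𝕜 N ∧
    ∀ i, rk (R := R) 𝕜 ((T P (i+1)).obj (ModuleCat.of R C)) = 
      rk (R := R) 𝕜 ((T P (i+1)).obj (ModuleCat.of R B)) +
      rk (R := R) 𝕜 ((T P i).obj (ModuleCat.of R A)) := by
  let S : ShortComplex (ModuleCat.{0} R) := ShortComplex.mk 
      (X₁ := ModuleCat.of R A) (X₂ := ModuleCat.of R (B × R)) (X₃ := ModuleCat.of R C)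
      (ModuleCat.ofHom (f.prod φ)) (ModuleCat.ofHom g) 
      (by ext a; exact hex.apply_apply_eq_zero a)
  have hS : S.ShortExact := by
    refine { exact := ?_, mono_f := ?_, epi_g := ?_ }
    · rw [ShortComplex.ShortExact.moduleCat_exact_iff_function_exact]
      exact hex
    · rw [ModuleCat.mono_iff_injective]
      exact hinj
    · rw [ModuleCat.epi_iff_surjective]
      exact hsur
  have hφ0 : ∀ i, (T P i).map (ModuleCat.ofHom φ) = 0 := by
    intro i
    cases i with
    | zero => exact T_zero_R P _ _ hφ
    | succ i => exact (T_R_succ P i).eq_of_tgt _ _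
  have hf0 : ∀ i, (T P i).map (ModuleCat.ofHom f) = 0 := by
    intro i
    obtain ⟨r, f', hr, rfl⟩ := hf
    have : ModuleCat.ofHom (r • f') = ModuleCat.ofHom f' ≫ (r • 𝟙 (ModuleCat.of R B)) := by
      ext; simp
    rw [this, Functor.map_comp, T_smul P r hr, Limits.comp_zero]
  have hz : ∀ i x, (T P i).map S.f x = 0 := by
    intro i x
    apply T_prod_zero P (ModuleCat.of R B) (ModuleCat.of R R) i
    · have h1 : S.f ≫ ModuleCat.ofHom (LinearMap.fst R B R) = ModuleCat.ofHom f := by ext; simp [S]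
      have := hf0 i
      rw [← h1, Functor.map_comp] at this
      exact congrArg (fun q => q.hom x) this
    · have h1 : S.f ≫ ModuleCat.ofHom (LinearMap.snd R B R) = ModuleCat.ofHom φ := by ext; simp [S]
      have := hφ0 i
      rw [← h1, Functor.map_comp] at this
      exact congrArg (fun q => q.hom x) this
  have hgi : ∀ i, Function.Injective ((T P i).map S.g).hom := by
    intro i
    rw [injective_iff_map_eq_zero]
    intro y hy
    obtain ⟨x, rfl⟩ := (T_mid P S hS i y).1 hy
    exact hz i x
  constructor
  · have h1 := rk_congr 𝕜 (LinearEquiv.ofBijective ((T P 0).map S.g).hom ⟨hgi 0, T_surj0 P S hS⟩)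
    have h2 := rk_congr 𝕜 (T_R_zero P).toLinearEquiv
    rw [← h2]
    exact h1.symm.trans (T_prod_rk P 𝕜 (ModuleCat.of R B) (ModuleCat.of R R) 0)
  · intro i
    obtain ⟨d, hd1, hd2⟩ := T_les P S hS i
    have h1 := rk_ses 𝕜 ((T P (i+1)).map S.g).hom d.hom (hgi _) (fun y => (hd2 y).1 (hz i y)) hd1
    have h2 := T_prod_rk P 𝕜 (ModuleCat.of R B) (ModuleCat.of R R) (i+1)
    have : Subsingleton ((T P (i+1)).obj (ModuleCat.of R R)) :=
      ModuleCat.subsingleton_of_isZero (T_R_succ P i)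
    have h3 : rk (R := R) 𝕜 ((T P (i+1)).obj (ModuleCat.of R R)) = 0 := rk_zero 𝕜
    rw [h3, add_zero] at h2
    rw [← h2]
    exact h1

lemma base {A : Type} [AddCommGroup A] [Module R A] [Subsingleton A] (i : ℕ) :
    rk (R := R) 𝕜 ((T P i).obj (ModuleCat.of R A)) = 0 := by
  have h0 : ModuleCat.ofHom (0 : A →ₗ[R] A) = (0 : R) • 𝟙 (ModuleCat.of R A) := by ext; simp
  have h1 : 𝟙 (ModuleCat.of R A) = (0 : R) • 𝟙 (ModuleCat.of R A) := by
    ext x; exact Subsingleton.elim (α := A) _ _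
  have h2 := T_smul P 0 (by simp) (ModuleCat.of R A) i
  rw [← h1, CategoryTheory.Functor.map_id] at h2
  have := ModuleCat.subsingleton_of_isZero ((Limits.IsZero.iff_id_eq_zero _).2 h2)
  exact rk_zero 𝕜

end rk
end abs

section alg
variable {𝕜 : Type} [Field 𝕜] {σ ι : Type}

noncomputable def ind (s : Finset σ) : σ →₀ ℕ := Finsupp.indicator s (fun _ _ => 1)

lemma ind_apply (s : Finset σ) (j : σ) : ind s j = if j ∈ s then 1 else 0 := by
  simp [ind, Finsupp.indicator_apply]

lemma sfMon_eq (s : Finset σ) : sfMon 𝕜 s = monomial (ind s) 1 := by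
  have h : ind s = ∑ j ∈ s, Finsupp.single j 1 := by
    ext j
    rw [ind_apply, Finsupp.finsetSum_apply]
    simp [Finsupp.single_apply]
  rw [h, sfMon, monomial_sum_one]
  rfl

lemma ind_le (s : Finset σ) (e : σ →₀ ℕ) : ind s ≤ e ↔ ∀ j ∈ s, e j ≠ 0 := by
  rw [Finsupp.le_def]
  refine forall_congr' fun j => ?_
  rw [ind_apply]
  split_ifs with h
  · simp [h, Nat.one_le_iff_ne_zero]
  · simp [h]

variable (𝕜) in
noncomputable def Id (S : Finset ι) (s : ι → Finset σ) : Ideal (MvPolynomial σ 𝕜) :=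
  Ideal.span ((fun i => sfMon 𝕜 (s i)) '' (S : Set ι))

lemma mem_Id (S : Finset ι) (s : ι → Finset σ) (f : MvPolynomial σ 𝕜) :
    f ∈ Id 𝕜 S s ↔ ∀ e ∈ f.support, ∃ i ∈ S, ∀ j ∈ s i, e j ≠ 0 := by
  have h : (fun i => sfMon 𝕜 (s i)) '' (S : Set ι) =
      (fun e => monomial e (1 : 𝕜)) '' ((fun i => ind (s i)) '' (S : Set ι)) := by
    rw [Set.image_image]
    simp only [sfMon_eq]
  rw [Id, h, mem_ideal_span_monomial_image]
  simp [ind_le]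

lemma mem_colon (S : Finset ι) (s : ι → Finset σ) (t : Finset σ) (f : MvPolynomial σ 𝕜) :
    sfMon 𝕜 t * f ∈ Id 𝕜 S s ↔ f ∈ Id 𝕜 S (fun i => s i \ t) := by
  rw [mem_Id, mem_Id, sfMon_eq]
  have key : ∀ e : σ →₀ ℕ, (∃ i ∈ S, ∀ j ∈ s i, (ind t + e) j ≠ 0) ↔
      ∃ i ∈ S, ∀ j ∈ s i \ t, e j ≠ 0 := by
    intro e
    refine exists_congr fun i => and_congr_right fun _ => forall_congr' fun j => ?_
    rw [Finsupp.add_apply, ind_apply, Finset.mem_sdiff]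
    by_cases h : j ∈ t <;> simp [h]
  constructor
  · intro h e he
    rw [← key]
    apply h
    rw [mem_support_iff] at he ⊢
    rwa [coeff_monomial_mul, one_mul]
  · intro h e he
    rw [mem_support_iff, coeff_monomial_mul'] at he
    split_ifs at he with hle
    · obtain ⟨e', rfl⟩ := le_iff_exists_add.1 hle
      rw [key]
      apply h
      rw [mem_support_iff]
      simpa using he
    · exact absurd rfl he

variable (𝕜 σ) in
noncomputable abbrev maxI : Ideal (MvPolynomial σ 𝕜) := Ideal.span (Set.range (X : σ → MvPolynomial σ 𝕜))

lemma mem_maxI (f : MvPolynomial σ 𝕜) : f ∈ maxI 𝕜 σ ↔ f.coeff 0 = 0 := by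
  rw [maxI, ← Set.image_univ, mem_ideal_span_X_image]
  constructor
  · intro h
    by_contra h0
    obtain ⟨i, -, hi⟩ := h 0 (mem_support_iff.2 h0)
    simp at hi
  · intro h m hm
    by_contra! hc
    have : m = 0 := by
      ext i; exact hc i (Set.mem_univ _)
    rw [this, mem_support_iff] at hm
    exact hm h

lemma kills {r : MvPolynomial σ 𝕜} (hr : r ∈ maxI 𝕜 σ) (x : MvPolynomial σ 𝕜 ⧸ maxI 𝕜 σ) :
    r • x = 0 := by
  obtain ⟨y, rfl⟩ := Ideal.Quotient.mk_surjective x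
  rw [← Ideal.Quotient.mk_eq_mk, ← Submodule.Quotient.mk_smul, Submodule.Quotient.mk_eq_zero]
  exact Ideal.mul_mem_right _ _ hr

lemma rkN : rk (R := MvPolynomial σ 𝕜) 𝕜 (MvPolynomial σ 𝕜 ⧸ maxI 𝕜 σ) = 1 := by
  rw [rk_eq]
  let _ := Module.compHom (MvPolynomial σ 𝕜 ⧸ maxI 𝕜 σ) (algebraMap 𝕜 (MvPolynomial σ 𝕜))
  let f : 𝕜 →ₗ[𝕜] (MvPolynomial σ 𝕜 ⧸ maxI 𝕜 σ) :=
    { toFun := fun c => Ideal.Quotient.mk _ (C c)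
      map_add' := by intro a b; simp
      map_smul' := by
        intro a b
        rw [smul_eq_mul, C_mul]
        rfl }
  have hf : Function.Bijective f := by
    constructor
    · rw [injective_iff_map_eq_zero]
      intro c hc
      have := Ideal.Quotient.eq_zero_iff_mem.1 hc
      rw [mem_maxI] at this
      simpa using this
    · intro x
      obtain ⟨y, rfl⟩ := Ideal.Quotient.mk_surjective x
      refine ⟨y.coeff 0, ?_⟩
      refine Ideal.Quotient.eq.2 ?_
      rw [mem_maxI]
      simp
  rw [← (LinearEquiv.ofBijective f hf).rank_eq, Module.rank_self]

lemma main (P : CategoryTheory.ProjectiveResolution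
      (ModuleCat.of (MvPolynomial σ 𝕜) (MvPolynomial σ 𝕜 ⧸ maxI 𝕜 σ)))
    (S : Finset ι) (p : ι → σ) : ∀ (s : ι → Finset σ)
    (_ : ∀ i ∈ S, ∀ j ∈ S, p i ∈ s j ↔ i = j) (d : ℕ),
    rk (R := MvPolynomial σ 𝕜) 𝕜 ((T P d).obj (ModuleCat.of _ (Id 𝕜 S s))) =
      ((S.card.choose (d + 1) : ℕ) : Cardinal) := by
  induction S using Finset.induction_on with
  | empty =>
    intro s _ d
    have : Subsingleton (Id 𝕜 (∅ : Finset ι) s) := by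
      have : Id 𝕜 (∅ : Finset ι) s = ⊥ := by simp [Id]
      rw [this]; infer_instance
    rw [base]
    simp
  | insert a S ha ih =>
    intro s hs d
    have hA := ih (fun i => s i \ s a) (by
      intro i hi j hj
      rw [Finset.mem_sdiff, hs i (Finset.mem_insert_of_mem hi) j (Finset.mem_insert_of_mem hj),
        hs i (Finset.mem_insert_of_mem hi) a (Finset.mem_insert_self _ _)]
      constructor
      · exact fun h => h.1
      · rintro rfl
        exact ⟨rfl, fun h => ha (h ▸ hi)⟩)
    have hB := ih s (fun i hi j hj => hs i (Finset.mem_insert_of_mem hi) j (Finset.mem_insert_of_mem hj))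
    have hpa : p a ∈ s a :=
      (hs a (Finset.mem_insert_self _ _) a (Finset.mem_insert_self _ _)).2 rfl
    have hpS : ∀ i ∈ S, p a ∉ s i := fun i hi h =>
      ha ((hs a (Finset.mem_insert_self _ _) i (Finset.mem_insert_of_mem hi)).1 h ▸ hi)
    have hmul : ∀ t : Finset σ, (∀ x ∈ Id 𝕜 S (fun i => s i \ s a), sfMon 𝕜 t * x ∈ Id 𝕜 S s) →
        ∃ f : Id 𝕜 S (fun i => s i \ s a) →ₗ[MvPolynomial σ 𝕜] Id 𝕜 S s,
          ∀ x, (f x : MvPolynomial σ 𝕜) = sfMon 𝕜 t * x := by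
      intro t ht
      refine ⟨LinearMap.restrict (LinearMap.mulLeft (MvPolynomial σ 𝕜) (sfMon 𝕜 t)) ht, ?_⟩
      intro x
      rfl
    obtain ⟨f, hf⟩ := hmul (s a) (fun x hx => (mem_colon _ _ _ _).2 hx)
    obtain ⟨f', hf'⟩ := hmul ((s a).erase (p a)) (by
      intro x hx
      rw [mem_colon]
      rw [mem_Id] at hx ⊢
      intro e he
      obtain ⟨i, hi, h⟩ := hx e he
      refine ⟨i, hi, fun j hj => h j ?_⟩
      rw [Finset.mem_sdiff] at hj ⊢
      refine ⟨hj.1, fun hja => hj.2 (Finset.mem_erase.2 ⟨?_, hja⟩)⟩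
      rintro rfl
      exact hpS i hi hj.1)
    have hma : sfMon 𝕜 (s a) ∈ Id 𝕜 (insert a S) s :=
      Ideal.subset_span ⟨a, by simp, rfl⟩
    have hle : Id 𝕜 S s ≤ Id 𝕜 (insert a S) s :=
      Ideal.span_mono (Set.image_mono (by simp))
    let φ : Id 𝕜 S (fun i => s i \ s a) →ₗ[MvPolynomial σ 𝕜] MvPolynomial σ 𝕜 :=
      -(Submodule.subtype _)
    let g : (Id 𝕜 S s × MvPolynomial σ 𝕜) →ₗ[MvPolynomial σ 𝕜] Id 𝕜 (insert a S) s :=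
      (Submodule.inclusion hle).coprod (LinearMap.toSpanSingleton _ _ ⟨_, hma⟩)
    have hg : ∀ b r, (g (b, r) : MvPolynomial σ 𝕜) = b + r * sfMon 𝕜 (s a) := by
      intro b r
      simp [g]
    have hstep := step P 𝕜 f φ g ?_ ?_ ?_ ?_ ?_
    · obtain ⟨h0, h1⟩ := hstep
      rw [Finset.card_insert_of_notMem ha]
      cases d with
      | zero =>
        rw [h0, hB, rkN]
        simp
      | succ d =>
        rw [h1, hA, hB, Nat.choose_succ_succ, ← Nat.cast_add, add_comm]
    · intro x y hxy
      have : φ x = φ y := congrArg Prod.snd hxy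
      have : -(x : MvPolynomial σ 𝕜) = -(y : MvPolynomial σ 𝕜) := this
      exact Subtype.ext (neg_injective this)
    · rintro ⟨b, r⟩
      rw [← Subtype.coe_inj, hg]
      constructor
      · intro h
        have hb : (b : MvPolynomial σ 𝕜) = sfMon 𝕜 (s a) * (-r) := by
          rw [mul_neg, mul_comm]
          exact eq_neg_of_add_eq_zero_left h
        refine ⟨⟨-r, (mem_colon _ _ _ _).1 (hb ▸ b.2)⟩, ?_⟩
        refine Prod.ext (Subtype.ext ?_) ?_
        · change (f _ : MvPolynomial σ 𝕜) = b
          rw [hf]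
          exact hb.symm
        · change -(-r) = r
          simp
      · rintro ⟨x, hx⟩
        have h1 : f x = b := congrArg Prod.fst hx
        have h2 : -(x : MvPolynomial σ 𝕜) = r := congrArg Prod.snd hx
        rw [← h1, ← h2, hf]
        change _ = (0 : MvPolynomial σ 𝕜)
        ring
    · rintro ⟨y, hy⟩
      have hy' := hy
      rw [Id, Finset.coe_insert, Set.image_insert_eq, Ideal.mem_span_insert] at hy'
      obtain ⟨r, z, hz, rfl⟩ := hy'
      refine ⟨(⟨z, hz⟩, r), Subtype.ext ?_⟩
      rw [hg]
      exact add_comm _ _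
    · intro x
      apply kills
      change -(x : MvPolynomial σ 𝕜) ∈ _
      rw [neg_mem_iff, mem_maxI]
      by_contra h0
      obtain ⟨i, hi, h⟩ := (mem_Id _ _ _).1 x.2 0 (mem_support_iff.2 h0)
      refine h (p i) ?_ rfl
      rw [Finset.mem_sdiff]
      refine ⟨(hs i (Finset.mem_insert_of_mem hi) i (Finset.mem_insert_of_mem hi)).2 rfl, fun h => ?_⟩
      exact ha ((hs i (Finset.mem_insert_of_mem hi) a (Finset.mem_insert_self _ _)).1 h ▸ hi)
    · refine ⟨X (p a), f', kills (Ideal.subset_span ⟨_, rfl⟩), ?_⟩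
      apply LinearMap.ext
      intro x
      apply Subtype.ext
      change _ = X (p a) * (f' x : MvPolynomial σ 𝕜)
      rw [hf, hf', ← mul_assoc, sfMon, sfMon, Finset.mul_prod_erase _ _ hpa]

end alg
end LeafProof

/-- Proposition 3.6: if `P` is a tree on `{1,…,n}` with exactly `k` leaves, then the leaf
ideal `I_L(P)` has exactly `k` minimal monomial generators and its Taylor complex (on these
`k` generators) minimally resolves it, i.e. `β_i(I_L(P)) = C(k, i+1)` for every `i ≥ 0`
(these ranks are exactly the ranks of the Taylor complex, so its minimality is equivalent to
these equalities). -/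
theorem stmt10 {𝕜 : Type} [Field 𝕜] (n k : ℕ) (P : PartialOrder (Fin n))
    (hforest : IsPForest P) (hroot : ∃! r : Fin n, PIsMin P r)
    (hk : (Finset.univ.filter (fun l : Fin n => PIsMax P l)).card = k) :
    (sqfreeMinGens (leafIdeal 𝕜 P)).ncard = k ∧
    ∀ i : ℕ, betti 𝕜 (leafIdeal 𝕜 P) i = ((Nat.choose k (i + 1) : ℕ) : Cardinal) := by
  have hP : ∀ l, P.le l l := P.le_refl
  let s : Fin n → Finset (Fin n) := fun l => Finset.univ.filter (fun j => P.le j l)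
  let S : Finset (Fin n) := Finset.univ.filter (fun l : Fin n => PIsMax P l)
  have hs : ∀ i ∈ S, ∀ j ∈ S, i ∈ s j ↔ i = j := by
    intro i hi j hj
    simp only [s, S, Finset.mem_filter, Finset.mem_univ, true_and] at *
    exact ⟨fun h => (hi j h).symm, fun h => h ▸ hP i⟩
  have hI : leafIdeal 𝕜 P = LeafProof.Id 𝕜 S s := by
    rw [leafIdeal, LeafProof.Id]
    congr 1
    ext f
    simp only [Set.mem_setOf_eq, Set.mem_image, S, s, Finset.coe_filter, Finset.mem_univ, true_and]
    exact ⟨fun ⟨l, h1, h2⟩ => ⟨l, h1, h2.symm⟩, fun ⟨l, h1, h2⟩ => ⟨l, h1, h2.symm⟩⟩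
  have hk' : S.card = k := by
    rw [← hk]
  rw [hI]
  constructor
  · have hmem : ∀ t : Finset (Fin n), sfMon 𝕜 t ∈ LeafProof.Id 𝕜 S s ↔ ∃ i ∈ S, s i ⊆ t := by
      intro t
      rw [LeafProof.mem_Id, LeafProof.sfMon_eq, support_monomial, if_neg one_ne_zero]
      simp [LeafProof.ind_apply, Finset.subset_iff]
    have hset : sqfreeMinGens (LeafProof.Id 𝕜 S s) = s '' (S : Set (Fin n)) := by
      ext t
      simp only [sqfreeMinGens, Set.mem_setOf_eq, hmem]
      constructor
      · rintro ⟨⟨i, hi, hit⟩, h⟩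
        refine ⟨i, hi, ?_⟩
        by_contra hne
        exact h (s i) (hit.ssubset_of_ne hne) ⟨i, hi, subset_rfl⟩
      · rintro ⟨i, hi, rfl⟩
        refine ⟨⟨i, hi, subset_rfl⟩, ?_⟩
        rintro t ht ⟨j, hj, hjt⟩
        have : j ∈ s i := ht.subset (hjt ((hs j hj j hj).2 rfl))
        obtain rfl := (hs j hj i hi).1 this
        exact ht.not_subset hjt
    rw [hset, Set.ncard_image_of_injOn, Set.ncard_coe_finset, hk']
    intro i hi j hj hij
    have : i ∈ s i := (hs i hi i hi).2 rfl
    rw [hij] at this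
    exact (hs i hi j hj).1 this
  · intro i
    let Q := CategoryTheory.projectiveResolution (ModuleCat.of (MvPolynomial (Fin n) 𝕜)
      (MvPolynomial (Fin n) 𝕜 ⧸ LeafProof.maxI 𝕜 (Fin n)))
    have h := LeafProof.main Q S (fun i => i) s hs i
    rw [hk'] at h
    rw [← h]
    exact LeafProof.rk_congr 𝕜 (LeafProof.torIso Q i _).toLinearEquiv
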